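/- (Proposition 3.5.) Let G be a discrete submonoid of ℝ≥0, let (C̄, {m_{k,λ}}) be a G-gapped filtered A∞-algebra over ℤ/2 in coefficientwise form, let (D̄, {n_{k,λ}}) be a G-gapped right filtered A∞-module over it, and let 𝟏 = (𝟏_λ)_{λ∈G} be a G-gapped cyclic element of D. Then there exists a unique G-gapped element b = (b_λ) of C ⊗ Λ₊ such that d^b(𝟏) = 0; moreover this unique b is a bounding cochain, i.e. it satisfies the Maurer–Cartan equation: for every positive λ ∈ G, Σ m_{k,μ}(b_{λ₁}, …, b_{λ_k}) = 0, the (finite) sum being over all k ≥ 0, all μ ∈ G and all positive λ₁, …, λ_k ∈ G with μ + λ₁ + ⋯ + λ_k = λ. -/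

import Mathlib

open scoped BigOperators

/-- A *discrete submonoid* of `ℝ≥0`: a set of nonnegative reals containing `0`,
closed under addition, and meeting every interval `[0, E]` in a finite set. -/
structure IsDiscreteSubmonoid (G : Set ℝ) : Prop where
  zero_mem : (0 : ℝ) ∈ G
  nonneg : ∀ x ∈ G, 0 ≤ x
  add_mem : ∀ x ∈ G, ∀ y ∈ G, x + y ∈ G
  finite_le : ∀ E : ℝ, {x | x ∈ G ∧ x ≤ E}.Finite

/-- `ℤ/2`-multilinearity of a family of operations `m k λ : C̄^k → C̄`, where a `k`-tuple of
elements of `C̄` is encoded as a function `ℕ → C` of which only the first `k` values matter: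
`m k λ` depends only on the first `k` arguments and is additive in each of them
(over `ℤ/2` every additive map is linear). -/
def OpsMultilinear {C : Type*} [AddCommGroup C] (m : ℕ → ℝ → (ℕ → C) → C) : Prop :=
  (∀ (k : ℕ) (lam : ℝ) (x y : ℕ → C), (∀ i < k, x i = y i) → m k lam x = m k lam y) ∧
  (∀ (k : ℕ) (lam : ℝ) (x : ℕ → C) (i : ℕ), i < k → ∀ a b : C,
    m k lam (Function.update x i (a + b)) =
      m k lam (Function.update x i a) + m k lam (Function.update x i b))

/-- `ℤ/2`-multilinearity of a family of operations `n k λ : D̄ × C̄^k → Ē`. -/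
def ModOpsMultilinear {C D E : Type*} [AddCommGroup C] [AddCommGroup D] [AddCommGroup E]
    (n : ℕ → ℝ → D → (ℕ → C) → E) : Prop :=
  (∀ (k : ℕ) (lam : ℝ) (y : D) (x x' : ℕ → C),
      (∀ i < k, x i = x' i) → n k lam y x = n k lam y x') ∧
  (∀ (k : ℕ) (lam : ℝ) (y y' : D) (x : ℕ → C),
      n k lam (y + y') x = n k lam y x + n k lam y' x) ∧
  (∀ (k : ℕ) (lam : ℝ) (y : D) (x : ℕ → C) (i : ℕ), i < k → ∀ a b : C,
    n k lam y (Function.update x i (a + b)) =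
      n k lam y (Function.update x i a) + n k lam y (Function.update x i b))

/-- The tuple `(x₁, …, x_j, c, x_{j+k₂+1}, …, x_k)` obtained from `(x₁, …, x_k)` by replacing
the `k₂` consecutive entries starting at (0-based) position `j` by the single entry `c`. -/
def insertAt {C : Type*} (x : ℕ → C) (j k₂ : ℕ) (c : C) : ℕ → C :=
  fun i => if i < j then x i else if i = j then c else x (i + k₂ - 1)

/-- A `G`-gapped filtered `A∞`-algebra over `ℤ/2` in coefficientwise form: the operations are
multilinear, `m_{0,0} = 0`, and for every `λ ∈ G` the coefficient of `T^λ` of the filtered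
`A∞`-relation holds (no signs: coefficients are in `ℤ/2`). -/
def IsGappedAInfAlgebra (G : Set ℝ) {C : Type*} [AddCommGroup C] [Module (ZMod 2) C]
    (m : ℕ → ℝ → (ℕ → C) → C) : Prop :=
  OpsMultilinear m ∧
  (∀ x : ℕ → C, m 0 0 x = 0) ∧
  (∀ lam ∈ G, ∀ (k : ℕ) (x : ℕ → C),
    (∑ᶠ (μ : ℝ) (ν : ℝ) (k₂ : ℕ) (j : ℕ)
        (_ : μ ∈ G ∧ ν ∈ G ∧ μ + ν = lam ∧ j + k₂ ≤ k),
      m (k + 1 - k₂) μ (insertAt x j k₂ (m k₂ ν fun t => x (j + t)))) = 0)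

/-- A `G`-gapped right filtered `A∞`-module `(D̄, n)` over `(C̄, m)` in coefficientwise form. -/
def IsGappedAInfModule (G : Set ℝ) {C D : Type*} [AddCommGroup C] [Module (ZMod 2) C]
    [AddCommGroup D] [Module (ZMod 2) D]
    (m : ℕ → ℝ → (ℕ → C) → C) (n : ℕ → ℝ → D → (ℕ → C) → D) : Prop :=
  ModOpsMultilinear n ∧
  (∀ lam ∈ G, ∀ (k : ℕ) (y : D) (x : ℕ → C),
    (∑ᶠ (μ : ℝ) (ν : ℝ) (ℓ : ℕ)
        (_ : μ ∈ G ∧ ν ∈ G ∧ μ + ν = lam ∧ ℓ ≤ k),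
      n (k - ℓ) μ (n ℓ ν y x) fun t => x (ℓ + t))
    +
    (∑ᶠ (μ : ℝ) (ν : ℝ) (k₂ : ℕ) (j : ℕ)
        (_ : μ ∈ G ∧ ν ∈ G ∧ μ + ν = lam ∧ j + k₂ ≤ k),
      n (k + 1 - k₂) μ y (insertAt x j k₂ (m k₂ ν fun t => x (j + t)))) = 0)

/-- A `G`-gapped *cyclic element* `𝟏 = (𝟏_λ)_{λ∈G}` of `D`:
(i) `x ↦ n_{1,0}(𝟏₀; x)` is a bijection `C̄ → D̄`, and (ii) `n_{0,0}(𝟏₀) = 0`. -/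
def IsCyclicElement {C D : Type*} [AddCommGroup C] [AddCommGroup D]
    (n : ℕ → ℝ → D → (ℕ → C) → D) (one : ℝ → D) : Prop :=
  Function.Bijective (fun x : C => n 1 0 (one 0) fun _ => x) ∧
  (∀ x : ℕ → C, n 0 0 (one 0) x = 0)

/-- The tuple `(b_{v 0}, …, b_{v (k-1)})` of values of a `G`-gapped element `b` of `C ⊗ Λ₊`
(encoded as a function `b : ℝ → C`, of which only the values at positive elements of `G`
matter), encoded as a function `ℕ → C`. -/
def bVec {C : Type*} [Zero C] (b : ℝ → C) {k : ℕ} (v : Fin k → ℝ) : ℕ → C :=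
  fun t => if h : t < k then b (v ⟨t, h⟩) else 0

/-- The Maurer–Cartan equation for a `G`-gapped element `b` of `C ⊗ Λ₊`: for every positive
`λ ∈ G`, the sum of `m_{k,μ}(b_{λ₁}, …, b_{λ_k})` over all `k ≥ 0`, `μ ∈ G` and positive
`λ₁, …, λ_k ∈ G` with `μ + λ₁ + ⋯ + λ_k = λ` vanishes. -/
def IsBoundingCochain (G : Set ℝ) {C : Type*} [AddCommGroup C]
    (m : ℕ → ℝ → (ℕ → C) → C) (b : ℝ → C) : Prop :=
  ∀ lam ∈ G, 0 < lam →
    (∑ᶠ (k : ℕ) (μ : ℝ) (v : Fin k → ℝ)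
        (_ : μ ∈ G ∧ (∀ i, v i ∈ G ∧ 0 < v i) ∧ μ + ∑ i, v i = lam),
      m k μ (bVec b v)) = 0

/-- The equation `d^b(𝟏) = 0` in coefficientwise form: for every `λ ∈ G`, the sum of
`n_{k,μ}(𝟏_ν; b_{λ₁}, …, b_{λ_k})` over all `k ≥ 0`, `μ, ν ∈ G` and positive
`λ₁, …, λ_k ∈ G` with `μ + ν + λ₁ + ⋯ + λ_k = λ` vanishes. -/
def KillsOne (G : Set ℝ) {C D : Type*} [AddCommGroup C] [AddCommGroup D]
    (n : ℕ → ℝ → D → (ℕ → C) → D) (one : ℝ → D) (b : ℝ → C) : Prop :=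
  ∀ lam ∈ G,
    (∑ᶠ (k : ℕ) (μ : ℝ) (ν : ℝ) (v : Fin k → ℝ)
        (_ : μ ∈ G ∧ ν ∈ G ∧ (∀ i, v i ∈ G ∧ 0 < v i) ∧ μ + ν + ∑ i, v i = lam),
      n k μ (one ν) (bVec b v)) = 0

/-- The operation `m_{k,λ}` applied to a list of length `k`. -/
def listOp {C M : Type*} [Zero C] (m : ℕ → ℝ → (ℕ → C) → M) (lam : ℝ) (cs : List C) : M :=
  m cs.length lam fun t => cs.getD t 0

/-- The module operation `n_{k,λ}` applied to an element and a list of length `k`. -/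
def listModOp {C D E : Type*} [Zero C] (n : ℕ → ℝ → D → (ℕ → C) → E) (lam : ℝ) (y : D)
    (cs : List C) : E :=
  n cs.length lam y fun t => cs.getD t 0

section Additivity

variable {C D E : Type*} [AddCommGroup C] [AddCommGroup D] [AddCommGroup E]
  {n : ℕ → ℝ → D → (ℕ → C) → E}

theorem listModOp_eq (hn : ModOpsMultilinear n) (lam : ℝ) (y : D) (cs : List C) (k : ℕ)
    (x : ℕ → C) (hk : cs.length = k) (hx : ∀ i < k, x i = cs.getD i 0) :
    n k lam y x = listModOp n lam y cs := by
  subst hk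
  exact hn.1 _ _ _ _ _ hx

theorem listModOp_add_left (hn : ModOpsMultilinear n) (lam : ℝ) (cs : List C) (y y' : D) :
    listModOp n lam (y + y') cs = listModOp n lam y cs + listModOp n lam y' cs :=
  hn.2.1 _ _ _ _ _

theorem listModOp_append_cons (hn : ModOpsMultilinear n) (lam : ℝ) (y : D) (as cs : List C)
    (c : C) :
    listModOp n lam y (as ++ c :: cs) = n (as.length + (cs.length + 1)) lam y
      (Function.update (fun t => (as ++ 0 :: cs).getD t 0) as.length c) := by
  symm
  apply listModOp_eq hn
  · simp
  · intro i _
    rcases lt_trichotomy i as.length with h | h | h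
    · rw [Function.update_of_ne h.ne, List.getD_append _ _ _ _ h, List.getD_append _ _ _ _ h]
    · subst h
      simp
    · rw [Function.update_of_ne h.ne', List.getD_append_right _ _ _ _ h.le,
        List.getD_append_right _ _ _ _ h.le]
      obtain ⟨d, hd⟩ : ∃ d, i - as.length = d + 1 := ⟨i - as.length - 1, by omega⟩
      simp [hd]

theorem listModOp_add_mid (hn : ModOpsMultilinear n) (lam : ℝ) (y : D) (as cs : List C)
    (c c' : C) :
    listModOp n lam y (as ++ (c + c') :: cs) =
      listModOp n lam y (as ++ c :: cs) + listModOp n lam y (as ++ c' :: cs) := by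
  simp only [listModOp_append_cons hn]
  exact hn.2.2 _ _ _ _ _ (by omega) _ _

/-- `listModOp` as an additive map in the module variable. -/
def listModOpLeft (hn : ModOpsMultilinear n) (lam : ℝ) (cs : List C) : D →+ E :=
  AddMonoidHom.mk' (fun y => listModOp n lam y cs) (listModOp_add_left hn lam cs)

/-- `listModOp` as an additive map in one of the algebra variables. -/
def listModOpMid (hn : ModOpsMultilinear n) (lam : ℝ) (y : D) (as cs : List C) : C →+ E :=
  AddMonoidHom.mk' (fun c => listModOp n lam y (as ++ c :: cs)) (listModOp_add_mid hn lam y as cs)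

end Additivity

namespace IsDiscreteSubmonoid

variable {G : Set ℝ}

theorem finite_words (hG : IsDiscreteSubmonoid G) (E : ℝ) :
    {l : List ℝ | (∀ x ∈ l, x ∈ G ∧ 0 < x) ∧ l.sum ≤ E}.Finite := by
  have bounded (P : Set ℝ) (hP : P.Finite) (k : ℕ) :
      {l : List ℝ | (∀ x ∈ l, x ∈ P) ∧ l.length ≤ k}.Finite := by
    induction k with
    | zero =>
      refine (Set.finite_singleton []).subset ?_
      rintro l ⟨-, hl⟩
      simpa using hl
    | succ k ih =>
      refine ((Set.finite_singleton []).union (hP.image2 List.cons ih)).subset ?_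
      rintro (_ | ⟨x, l⟩) ⟨h, hl⟩
      · simp
      · right
        simp only [List.mem_cons, forall_eq_or_imp, List.length_cons] at h hl
        exact ⟨x, h.1, l, ⟨h.2, by omega⟩, rfl⟩
  set P : Set ℝ := {x | (x ∈ G ∧ 0 < x) ∧ x ≤ E} with hP
  have hPfin : P.Finite := (hG.finite_le E).subset fun x hx => ⟨hx.1.1, hx.2⟩
  obtain ⟨δ, hδ, hδP⟩ : ∃ δ : ℝ, 0 < δ ∧ ∀ x ∈ P, δ ≤ x := by
    rcases P.eq_empty_or_nonempty with h | h
    · exact ⟨1, one_pos, by simp [h]⟩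
    · obtain ⟨δ, hδ, hmin⟩ := hPfin.exists_minimalFor id P h
      exact ⟨δ, hδ.1.2, fun x hx => (le_total δ x).elim id fun h => hmin hx h⟩
  refine (bounded P hPfin ⌊E / δ⌋₊).subset ?_
  rintro l ⟨hl, hE⟩
  have hmem : ∀ x ∈ l, x ∈ P := fun x hx =>
    ⟨hl x hx, (List.single_le_sum (fun y hy => (hl y hy).2.le) x hx).trans hE⟩
  refine ⟨hmem, Nat.le_floor ?_⟩
  rw [le_div_iff₀ hδ]
  have := List.card_nsmul_le_sum l δ fun x hx => hδP x (hmem x hx)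
  rw [nsmul_eq_mul] at this
  exact this.trans hE

/-- The elements of `G` of size at most `E`. -/
noncomputable def energies (hG : IsDiscreteSubmonoid G) (E : ℝ) : Finset ℝ :=
  (hG.finite_le E).toFinset

/-- The lists of positive elements of `G` of sum at most `E`. -/
noncomputable def words (hG : IsDiscreteSubmonoid G) (E : ℝ) : Finset (List ℝ) :=
  (hG.finite_words E).toFinset

theorem mem_energies (hG : IsDiscreteSubmonoid G) {E x : ℝ} :
    x ∈ hG.energies E ↔ x ∈ G ∧ x ≤ E := by
  simp [energies]

theorem mem_words (hG : IsDiscreteSubmonoid G) {E : ℝ} {l : List ℝ} :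
    l ∈ hG.words E ↔ (∀ x ∈ l, x ∈ G ∧ 0 < x) ∧ l.sum ≤ E := by
  simp [words]

theorem sum_nonneg_of_mem_words (hG : IsDiscreteSubmonoid G) {E : ℝ} {l : List ℝ}
    (hl : l ∈ hG.words E) : 0 ≤ l.sum :=
  List.sum_nonneg fun x hx => ((hG.mem_words.1 hl).1 x hx).2.le

theorem sum_mem_of_mem_words (hG : IsDiscreteSubmonoid G) {E : ℝ} {l : List ℝ}
    (hl : l ∈ hG.words E) : l.sum ∈ G := by
  have h := (hG.mem_words.1 hl).1
  clear hl
  induction l with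
  | nil => simpa using hG.zero_mem
  | cons a l ih =>
    simp only [List.mem_cons, forall_eq_or_imp] at h
    simpa using hG.add_mem _ h.1.1 _ (ih h.2)

theorem eq_nil_of_sum_le_zero (hG : IsDiscreteSubmonoid G) {E : ℝ} {l : List ℝ}
    (hl : l ∈ hG.words E) (h0 : l.sum ≤ 0) : l = [] := by
  rw [hG.mem_words] at hl
  rcases l with _ | ⟨a, l⟩
  · rfl
  · have h := List.single_le_sum (fun y hy => (hl.1 y hy).2.le) a (by simp)
    linarith [(hl.1 a (by simp)).2]

theorem append_mem_words (hG : IsDiscreteSubmonoid G) {E : ℝ} {l l' : List ℝ} :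
    l ++ l' ∈ hG.words E ↔ l ∈ hG.words E ∧ l' ∈ hG.words E ∧ l.sum + l'.sum ≤ E := by
  refine ⟨fun h => ?_, fun ⟨h, h', hE⟩ => ?_⟩
  · simp only [mem_words, List.mem_append, List.sum_append] at h ⊢
    have h1 : 0 ≤ l.sum := List.sum_nonneg fun x hx => (h.1 x (.inl hx)).2.le
    have h2 : 0 ≤ l'.sum := List.sum_nonneg fun x hx => (h.1 x (.inr hx)).2.le
    exact ⟨⟨fun x hx => h.1 x (.inl hx), by linarith⟩, ⟨fun x hx => h.1 x (.inr hx), by linarith⟩,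
      h.2⟩
  · simp only [mem_words, List.mem_append, List.sum_append] at h h' ⊢
    exact ⟨fun x hx => hx.elim (h.1 x) (h'.1 x), hE⟩

theorem wellFounded (hG : IsDiscreteSubmonoid G) :
    WellFounded fun x y : ℝ => x < y ∧ x ∈ G ∧ y ∈ G := by
  refine Subrelation.wf (r := InvImage (· < ·) fun E => (hG.energies E).card) ?_
    (InvImage.wf _ wellFounded_lt)
  rintro x y ⟨hxy, hx, hy⟩
  refine Finset.card_lt_card (Finset.ssubset_iff_of_subset ?_ |>.2 ⟨y, ?_, ?_⟩)
  · intro z hz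
    rw [mem_energies] at hz ⊢
    exact ⟨hz.1, hz.2.trans hxy.le⟩
  · exact hG.mem_energies.2 ⟨hy, le_rfl⟩
  · simp [mem_energies, hxy]

/-- Recursion on the elements of `G`: a value prescribed in terms of smaller values exists. -/
theorem exists_recursive {C : Type*} [Zero C] (hG : IsDiscreteSubmonoid G)
    (Φ : ℝ → (ℝ → C) → C)
    (hΦ : ∀ e ∈ G, ∀ b b' : ℝ → C, (∀ x ∈ G, x < e → b x = b' x) → Φ e b = Φ e b') :
    ∃ b : ℝ → C, ∀ e ∈ G, b e = Φ e b := by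
  classical
  refine ⟨hG.wellFounded.fix fun e ih => Φ e fun x =>
    if h : x < e ∧ x ∈ G ∧ e ∈ G then ih x h else 0, fun e he => ?_⟩
  rw [hG.wellFounded.fix_eq]
  refine hΦ e he _ _ fun x hx hxe => ?_
  simp [hx, hxe, he]

end IsDiscreteSubmonoid

section Finsum

variable {M : Type*} [AddCommMonoid M]

theorem finsum_eq_sum_of_forall_notMem {α : Type*} (s : Finset α) {f : α → M}
    (h : ∀ a ∉ s, f a = 0) : ∑ᶠ a, f a = ∑ a ∈ s, f a :=
  finsum_eq_sum_of_support_subset f fun a ha => by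
    by_contra hs
    exact ha (h a hs)

theorem finsum_fin_tuple {α : Type*} [DecidableEq α] (s : Finset (List α)) (H : List α → M)
    (hH : ∀ l ∉ s, H l = 0) (k : ℕ) :
    ∑ᶠ v : Fin k → α, H (List.ofFn v) = ∑ l ∈ s, if l.length = k then H l else 0 := by
  rw [← finsum_mem_range (f := H) List.ofFn_injective]
  have hr (l : List α) : l ∈ Set.range (List.ofFn : (Fin k → α) → List α) ↔ l.length = k := by
    constructor
    · rintro ⟨v, rfl⟩
      simp
    · rintro rfl
      exact ⟨l.get, List.ofFn_get l⟩
  simp only [hr, finsum_eq_if]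
  exact finsum_eq_sum_of_forall_notMem _ fun l hl => by simp [hH l hl]

theorem finsum_eq_sum_lists {α : Type*} [DecidableEq α] (s : Finset (List α)) (H : List α → M)
    (g : ℕ → M) (hg : ∀ k, g k = ∑ l ∈ s, if l.length = k then H l else 0) :
    ∑ᶠ k, g k = ∑ l ∈ s, H l := by
  rw [finsum_eq_sum_of_forall_notMem (s.image List.length)]
  · simp only [hg]
    rw [Finset.sum_comm]
    refine Finset.sum_congr rfl fun l hl => ?_
    rw [Finset.sum_ite_eq, if_pos (Finset.mem_image_of_mem _ hl)]
  · intro k hk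
    rw [hg]
    refine Finset.sum_eq_zero fun l hl => if_neg ?_
    rintro rfl
    exact hk (Finset.mem_image_of_mem _ hl)

end Finsum

section Splittings

variable {M : Type*} [AddCommMonoid M] {G : Set ℝ}

theorem sum_words_append (hG : IsDiscreteSubmonoid G) {E : ℝ} {l : List ℝ}
    (hl : l ∈ hG.words E) (F : List ℝ → List ℝ → M) :
    (∑ l₁ ∈ hG.words E, ∑ l₂ ∈ hG.words E, if l₁ ++ l₂ = l then F l₁ l₂ else 0) =
      ∑ i ∈ Finset.range (l.length + 1), F (l.take i) (l.drop i) := by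
  rw [← Finset.sum_product', ← Finset.sum_filter]
  refine Finset.sum_bij' (fun p _ => p.1.length) (fun i _ => (l.take i, l.drop i)) ?_ ?_ ?_ ?_ ?_
  · rintro ⟨l₁, l₂⟩ h
    obtain ⟨-, rfl⟩ := Finset.mem_filter.1 h
    simp only [Finset.mem_range, List.length_append]
    omega
  · intro i _
    rw [← List.take_append_drop i l, hG.append_mem_words] at hl
    simp [hl.1, hl.2.1]
  · rintro ⟨l₁, l₂⟩ h
    obtain ⟨-, rfl⟩ := Finset.mem_filter.1 h
    simp
  · intro i hi
    rw [Finset.mem_range] at hi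
    simp only [List.length_take]
    omega
  · rintro ⟨l₁, l₂⟩ h
    obtain ⟨-, rfl⟩ := Finset.mem_filter.1 h
    simp

theorem sum_words_append_append (hG : IsDiscreteSubmonoid G) {E : ℝ} {l : List ℝ}
    (hl : l ∈ hG.words E) (F : List ℝ → List ℝ → List ℝ → M) :
    (∑ l₁ ∈ hG.words E, ∑ l₂ ∈ hG.words E, ∑ l₃ ∈ hG.words E,
        if l₁ ++ (l₂ ++ l₃) = l then F l₁ l₂ l₃ else 0) =
      ∑ i ∈ Finset.range (l.length + 1), ∑ j ∈ Finset.range (l.length + 1),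
        if j + i ≤ l.length then F (l.take j) ((l.drop j).take i) (l.drop (j + i)) else 0 := by
  have h₁ : ∀ i ∈ Finset.range (l.length + 1), l.drop i ∈ hG.words E := fun i _ => by
    rw [← List.take_append_drop i l, hG.append_mem_words] at hl
    exact hl.2.1
  calc
    _ = ∑ l₁ ∈ hG.words E, ∑ l' ∈ hG.words E, if l₁ ++ l' = l then
          ∑ l₂ ∈ hG.words E, ∑ l₃ ∈ hG.words E, if l₂ ++ l₃ = l' then F l₁ l₂ l₃ else 0
          else 0 := by
      refine Finset.sum_congr rfl fun l₁ _ => ?_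
      have collapse (l₂ l₃ : List ℝ) : (if l₁ ++ (l₂ ++ l₃) = l then F l₁ l₂ l₃ else 0) =
          ∑ l' ∈ hG.words E, if l₁ ++ l' = l then if l₂ ++ l₃ = l' then F l₁ l₂ l₃ else 0
            else 0 := by
        rw [Finset.sum_eq_single (l₂ ++ l₃), if_pos rfl]
        · intro l' _ h
          rw [if_neg h.symm, ite_self]
        · intro h
          refine if_neg ?_
          rintro rfl
          exact h (hG.append_mem_words.1 hl).2.1
      refine (Finset.sum_congr rfl fun l₂ _ => (Finset.sum_congr rfl fun l₃ _ =>
        collapse l₂ l₃).trans Finset.sum_comm).trans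
          (Finset.sum_comm.trans (Finset.sum_congr rfl fun l' _ => ?_))
      simp only [Finset.sum_ite_irrel, Finset.sum_const_zero]
    _ = _ := by
      rw [sum_words_append hG hl fun l₁ l' =>
        ∑ l₂ ∈ hG.words E, ∑ l₃ ∈ hG.words E, if l₂ ++ l₃ = l' then F l₁ l₂ l₃ else 0]
      rw [Finset.sum_comm (s := Finset.range (l.length + 1)) (t := Finset.range (l.length + 1))]
      refine Finset.sum_congr rfl fun j hj => ?_
      rw [sum_words_append hG (h₁ j hj), ← Finset.sum_filter]
      rw [Finset.mem_range] at hj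
      refine Finset.sum_congr ?_ fun i _ => by rw [List.drop_drop]
      ext i
      simp only [Finset.mem_range, List.length_drop, Finset.mem_filter]
      omega

end Splittings

section Expansion

variable {G : Set ℝ} {C D : Type*} [AddCommGroup C] [AddCommGroup D]

theorem bVec_eq_getD (b : ℝ → C) {k : ℕ} (v : Fin k → ℝ) :
    bVec b v = fun t => ((List.ofFn v).map b).getD t 0 := by
  funext t
  by_cases h : t < k <;> simp [bVec, h]

theorem ops_bVec {M : Type*} (m : ℕ → ℝ → (ℕ → C) → M) (lam : ℝ) (b : ℝ → C) {k : ℕ}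
    (v : Fin k → ℝ) : m k lam (bVec b v) = listOp m lam ((List.ofFn v).map b) := by
  simp [listOp, bVec_eq_getD]

theorem modOps_bVec {D : Type*} (n : ℕ → ℝ → D → (ℕ → C) → D) (lam : ℝ) (y : D) (b : ℝ → C) {k : ℕ}
    (v : Fin k → ℝ) : n k lam y (bVec b v) = listModOp n lam y ((List.ofFn v).map b) := by
  simp [listModOp, bVec_eq_getD]

open Classical in
theorem finsum_maurerCartan (hG : IsDiscreteSubmonoid G) (m : ℕ → ℝ → (ℕ → C) → C) (b : ℝ → C)
    {E e : ℝ} (he : e ≤ E) :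
    (∑ᶠ (k : ℕ) (μ : ℝ) (v : Fin k → ℝ)
        (_ : μ ∈ G ∧ (∀ i, v i ∈ G ∧ 0 < v i) ∧ μ + ∑ i, v i = e), m k μ (bVec b v)) =
      ∑ l ∈ hG.words E, ∑ μ ∈ hG.energies E,
        if μ + l.sum = e then listOp m μ (l.map b) else 0 := by
  refine finsum_eq_sum_lists _ _ _ fun k => ?_
  let H (μ : ℝ) (l : List ℝ) : C :=
    if μ ∈ G ∧ (∀ x ∈ l, x ∈ G ∧ 0 < x) ∧ μ + l.sum = e then listOp m μ (l.map b) else 0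
  have hH (μ : ℝ) (v : Fin k → ℝ) :
      (∑ᶠ (_ : μ ∈ G ∧ (∀ i, v i ∈ G ∧ 0 < v i) ∧ μ + ∑ i, v i = e), m k μ (bVec b v)) =
        H μ (List.ofFn v) := by
    simp only [H, finsum_eq_if, ops_bVec, List.forall_mem_ofFn_iff, List.sum_ofFn]
  have hHl (μ : ℝ) : ∀ l ∉ hG.words E, H μ l = 0 := fun l hl => if_neg fun h =>
    hl (hG.mem_words.2 ⟨h.2.1, by linarith [hG.nonneg _ h.1]⟩)
  simp only [hH, finsum_fin_tuple _ _ (hHl _)]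
  rw [finsum_eq_sum_of_forall_notMem (hG.energies E), Finset.sum_comm]
  · refine Finset.sum_congr rfl fun l hl => ?_
    rw [Finset.sum_ite_irrel, Finset.sum_const_zero]
    congr 1
    refine Finset.sum_congr rfl fun μ hμ => ?_
    exact if_congr ⟨fun h => h.2.2, fun h =>
      ⟨(hG.mem_energies.1 hμ).1, (hG.mem_words.1 hl).1, h⟩⟩ rfl rfl
  · intro μ hμ
    refine Finset.sum_eq_zero fun l hl => ?_
    rw [ite_eq_right_iff]
    exact fun _ => if_neg fun h => hμ (hG.mem_energies.2
      ⟨h.1, by linarith [hG.sum_nonneg_of_mem_words hl]⟩)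

open Classical in
theorem finsum_killsOne (hG : IsDiscreteSubmonoid G) (n : ℕ → ℝ → D → (ℕ → C) → D) (one : ℝ → D)
    (b : ℝ → C) {E e : ℝ} (he : e ≤ E) :
    (∑ᶠ (k : ℕ) (μ : ℝ) (ν : ℝ) (v : Fin k → ℝ)
        (_ : μ ∈ G ∧ ν ∈ G ∧ (∀ i, v i ∈ G ∧ 0 < v i) ∧ μ + ν + ∑ i, v i = e),
      n k μ (one ν) (bVec b v)) =
      ∑ l ∈ hG.words E, ∑ μ ∈ hG.energies E, ∑ ν ∈ hG.energies E,
        if μ + ν + l.sum = e then listModOp n μ (one ν) (l.map b) else 0 := by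
  refine finsum_eq_sum_lists _ _ _ fun k => ?_
  let H (μ ν : ℝ) (l : List ℝ) : D :=
    if μ ∈ G ∧ ν ∈ G ∧ (∀ x ∈ l, x ∈ G ∧ 0 < x) ∧ μ + ν + l.sum = e then
      listModOp n μ (one ν) (l.map b) else 0
  have hH (μ ν : ℝ) (v : Fin k → ℝ) :
      (∑ᶠ (_ : μ ∈ G ∧ ν ∈ G ∧ (∀ i, v i ∈ G ∧ 0 < v i) ∧ μ + ν + ∑ i, v i = e),
        n k μ (one ν) (bVec b v)) = H μ ν (List.ofFn v) := by
    simp only [H, finsum_eq_if, modOps_bVec, List.forall_mem_ofFn_iff, List.sum_ofFn]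
  have hHl (μ ν : ℝ) : ∀ l ∉ hG.words E, H μ ν l = 0 := fun l hl => if_neg fun h =>
    hl (hG.mem_words.2 ⟨h.2.2.1, by linarith [hG.nonneg _ h.1, hG.nonneg _ h.2.1]⟩)
  have hHν (μ : ℝ) : ∀ ν ∉ hG.energies E, ∀ l ∈ hG.words E, H μ ν l = 0 := fun ν hν l hl =>
    if_neg fun h => hν (hG.mem_energies.2 ⟨h.2.1, by
      linarith [hG.nonneg _ h.1, hG.sum_nonneg_of_mem_words hl]⟩)
  have hHμ : ∀ μ ∉ hG.energies E, ∀ ν, ∀ l ∈ hG.words E, H μ ν l = 0 := fun μ hμ ν l hl =>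
    if_neg fun h => hμ (hG.mem_energies.2 ⟨h.1, by
      linarith [hG.nonneg _ h.2.1, hG.sum_nonneg_of_mem_words hl]⟩)
  have hν (μ : ℝ) :
      (∑ᶠ ν : ℝ, ∑ l ∈ hG.words E, if l.length = k then H μ ν l else 0) =
      ∑ ν ∈ hG.energies E, ∑ l ∈ hG.words E, if l.length = k then H μ ν l else 0 :=
    finsum_eq_sum_of_forall_notMem _ fun ν hν => Finset.sum_eq_zero fun l hl => by
      rw [hHν μ ν hν l hl, ite_self]
  simp only [hH, finsum_fin_tuple _ _ (hHl _ _), hν]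
  rw [finsum_eq_sum_of_forall_notMem (hG.energies E)]
  · simp only [Finset.sum_comm (s := hG.energies E) (t := hG.words E)]
    refine Finset.sum_congr rfl fun l hl => ?_
    simp only [Finset.sum_ite_irrel, Finset.sum_const_zero]
    congr 1
    refine Finset.sum_congr rfl fun μ hμ => Finset.sum_congr rfl fun ν hν => ?_
    exact if_congr ⟨fun h => h.2.2.2, fun h => ⟨(hG.mem_energies.1 hμ).1,
      (hG.mem_energies.1 hν).1, (hG.mem_words.1 hl).1, h⟩⟩ rfl rfl
  · intro μ hμ
    refine Finset.sum_eq_zero fun ν _ => Finset.sum_eq_zero fun l hl => ?_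
    rw [hHμ μ hμ ν l hl, ite_self]

end Expansion

theorem Finset.sum_ite_sum_fiber {α β M : Type*} [AddCommMonoid M] [DecidableEq α]
    (A : Finset α) (B : Finset β) (p : β → α) (X : β → M) (c : α → Prop) [DecidablePred c]
    (h : ∀ b ∈ B, c (p b) → p b ∈ A) :
    (∑ a ∈ A, if c a then ∑ b ∈ B, if p b = a then X b else 0 else 0) =
      ∑ b ∈ B, if c (p b) then X b else 0 := by
  have swap (a : α) : (if c a then ∑ b ∈ B, if p b = a then X b else 0 else 0) =
      ∑ b ∈ B, if p b = a then if c a then X b else 0 else 0 := by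
    by_cases hc : c a <;> simp [hc]
  simp only [swap]
  rw [Finset.sum_comm]
  refine Finset.sum_congr rfl fun b hb => ?_
  rw [Finset.sum_ite_eq]
  split_ifs with h₁ h₂ h₂
  · rfl
  · rfl
  · exact absurd (h b hb h₂) h₁
  · rfl

section Coefficients

variable {G : Set ℝ} {C D : Type*} [AddCommGroup C] [AddCommGroup D]

/-- The coefficient of `T^e` of the Maurer–Cartan equation, as a finite sum. -/
noncomputable def mcCoeff (hG : IsDiscreteSubmonoid G) (m : ℕ → ℝ → (ℕ → C) → C) (b : ℝ → C)
    (E e : ℝ) : C :=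
  ∑ r ∈ hG.words E ×ˢ hG.energies E, if r.2 + r.1.sum = e then listOp m r.2 (r.1.map b) else 0

/-- The coefficient of `T^e` of `d^b(𝟏)`, as a finite sum. -/
noncomputable def killCoeff (hG : IsDiscreteSubmonoid G) (n : ℕ → ℝ → D → (ℕ → C) → D)
    (one : ℝ → D) (b : ℝ → C) (E e : ℝ) : D :=
  ∑ r ∈ hG.words E ×ˢ hG.energies E ×ˢ hG.energies E,
    if r.2.1 + r.2.2 + r.1.sum = e then listModOp n r.2.1 (one r.2.2) (r.1.map b) else 0

theorem isBoundingCochain_iff (hG : IsDiscreteSubmonoid G) (m : ℕ → ℝ → (ℕ → C) → C)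
    (b : ℝ → C) : IsBoundingCochain G m b ↔ ∀ E ∈ G, 0 < E → mcCoeff hG m b E E = 0 := by
  simp only [IsBoundingCochain, finsum_maurerCartan hG m b le_rfl, mcCoeff, Finset.sum_product]

theorem mcCoeff_eq (hG : IsDiscreteSubmonoid G) (m : ℕ → ℝ → (ℕ → C) → C) (b : ℝ → C)
    {E e : ℝ} (he : e ≤ E) : mcCoeff hG m b E e = mcCoeff hG m b e e := by
  simp only [mcCoeff, Finset.sum_product, ← finsum_maurerCartan hG m b le_rfl,
    ← finsum_maurerCartan hG m b he]

theorem killsOne_iff (hG : IsDiscreteSubmonoid G) (n : ℕ → ℝ → D → (ℕ → C) → D) (one : ℝ → D)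
    (b : ℝ → C) : KillsOne G n one b ↔ ∀ E ∈ G, killCoeff hG n one b E E = 0 := by
  simp only [KillsOne, finsum_killsOne hG n one b le_rfl, killCoeff, Finset.sum_product]

theorem killCoeff_eq (hG : IsDiscreteSubmonoid G) (n : ℕ → ℝ → D → (ℕ → C) → D) (one : ℝ → D)
    (b : ℝ → C) {E e : ℝ} (he : e ≤ E) :
    killCoeff hG n one b E e = killCoeff hG n one b e e := by
  simp only [killCoeff, Finset.sum_product, ← finsum_killsOne hG n one b le_rfl,
    ← finsum_killsOne hG n one b he]

theorem IsDiscreteSubmonoid.energies_zero (hG : IsDiscreteSubmonoid G) : hG.energies 0 = {0} := by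
  ext x
  rw [hG.mem_energies, Finset.mem_singleton]
  exact ⟨fun h => le_antisymm h.2 (hG.nonneg x h.1), by rintro rfl; exact ⟨hG.zero_mem, le_rfl⟩⟩

theorem IsDiscreteSubmonoid.words_zero (hG : IsDiscreteSubmonoid G) : hG.words 0 = {[]} := by
  ext l
  rw [Finset.mem_singleton]
  refine ⟨fun h => hG.eq_nil_of_sum_le_zero h (hG.mem_words.1 h).2, ?_⟩
  rintro rfl
  simp [hG.mem_words]

theorem mcCoeff_zero (hG : IsDiscreteSubmonoid G) {m : ℕ → ℝ → (ℕ → C) → C} (b : ℝ → C)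
    (hm : ∀ x : ℕ → C, m 0 0 x = 0) : mcCoeff hG m b 0 0 = 0 := by
  simp [mcCoeff, hG.energies_zero, hG.words_zero, listOp, hm]

theorem killCoeff_zero (hG : IsDiscreteSubmonoid G) {n : ℕ → ℝ → D → (ℕ → C) → D} {one : ℝ → D}
    (b : ℝ → C) (hone : ∀ x : ℕ → C, n 0 0 (one 0) x = 0) : killCoeff hG n one b 0 0 = 0 := by
  simp [killCoeff, hG.energies_zero, hG.words_zero, listModOp, hone]

/-- The part of the coefficient of `T^E` of `d^b(𝟏)` that involves only `b_λ` with `λ < E`. -/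
noncomputable def killRest (hG : IsDiscreteSubmonoid G) (n : ℕ → ℝ → D → (ℕ → C) → D)
    (one : ℝ → D) (b : ℝ → C) (E : ℝ) : D :=
  ∑ r ∈ (hG.words E ×ˢ hG.energies E ×ˢ hG.energies E).erase ([E], 0, 0),
    if r.2.1 + r.2.2 + r.1.sum = E then listModOp n r.2.1 (one r.2.2) (r.1.map b) else 0

theorem killCoeff_eq_add_killRest (hG : IsDiscreteSubmonoid G)
    {n : ℕ → ℝ → D → (ℕ → C) → D} (hn : ModOpsMultilinear n) (one : ℝ → D) (b : ℝ → C) {E : ℝ}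
    (hE : E ∈ G) (hpos : 0 < E) :
    killCoeff hG n one b E E = (n 1 0 (one 0) fun _ => b E) + killRest hG n one b E := by
  have hmem : (([E], 0, 0) : List ℝ × ℝ × ℝ) ∈ hG.words E ×ˢ hG.energies E ×ˢ hG.energies E := by
    simp [hG.mem_words, hG.mem_energies, hE, hpos, hpos.le, hG.zero_mem]
  rw [killCoeff, ← Finset.add_sum_erase _ _ hmem, killRest]
  congr 1
  rw [listModOp_eq hn 0 (one 0) [b E] 1 _ rfl (by simp)]
  simp

theorem killRest_congr (hG : IsDiscreteSubmonoid G) (n : ℕ → ℝ → D → (ℕ → C) → D)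
    (one : ℝ → D) {b b' : ℝ → C} {E : ℝ} (h : ∀ x ∈ G, 0 < x → x < E → b x = b' x) :
    killRest hG n one b E = killRest hG n one b' E := by
  refine Finset.sum_congr rfl ?_
  rintro ⟨l, μ, ν⟩ hr
  simp only [Finset.mem_erase, Finset.mem_product, ne_eq] at hr
  obtain ⟨hne, hl, hμ, hν⟩ := hr
  by_cases hsum : μ + ν + l.sum = E
  · rw [if_pos hsum, if_pos hsum]
    dsimp only
    congr 1
    refine List.map_congr_left fun x hx => ?_
    have hxG := (hG.mem_words.1 hl).1 x hx
    refine h x hxG.1 hxG.2 (lt_of_not_ge fun hxE => hne ?_)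
    obtain ⟨s, t, rfl⟩ := List.append_of_mem hx
    have hl' := hl
    rw [← List.singleton_append, hG.append_mem_words, hG.append_mem_words] at hl'
    obtain ⟨hs, ⟨-, ht, -⟩, -⟩ := hl'
    have h₁ := hG.nonneg μ (hG.mem_energies.1 hμ).1
    have h₂ := hG.nonneg ν (hG.mem_energies.1 hν).1
    have h₃ := hG.sum_nonneg_of_mem_words hs
    have h₄ := hG.sum_nonneg_of_mem_words ht
    simp only [List.sum_append, List.sum_cons] at hsum
    rw [hG.eq_nil_of_sum_le_zero hs (by linarith), hG.eq_nil_of_sum_le_zero ht (by linarith)]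
    simp only [List.nil_append, Prod.mk.injEq, List.cons.injEq, and_true]
    exact ⟨by linarith, by linarith, by linarith⟩
  · rw [if_neg hsum, if_neg hsum]

theorem exists_killsOne (hG : IsDiscreteSubmonoid G) {n : ℕ → ℝ → D → (ℕ → C) → D}
    (hn : ModOpsMultilinear n) {one : ℝ → D} (hone : IsCyclicElement n one) :
    ∃ b : ℝ → C, KillsOne G n one b := by
  obtain ⟨b, hb⟩ := hG.exists_recursive
    (fun E b => (Equiv.ofBijective _ hone.1).symm (-killRest hG n one b E))
    fun E _ b b' h => by rw [killRest_congr hG n one fun x hx _ hxE => h x hx hxE]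
  refine ⟨b, (killsOne_iff hG n one b).2 fun E hE => ?_⟩
  rcases (hG.nonneg E hE).eq_or_lt with rfl | hpos
  · exact killCoeff_zero hG b hone.2
  · rw [killCoeff_eq_add_killRest hG hn one b hE hpos, hb E hE, add_eq_zero_iff_eq_neg]
    exact (Equiv.ofBijective _ hone.1).apply_symm_apply _

theorem killsOne_unique (hG : IsDiscreteSubmonoid G) {n : ℕ → ℝ → D → (ℕ → C) → D}
    (hn : ModOpsMultilinear n) {one : ℝ → D} (hone : IsCyclicElement n one) {b b' : ℝ → C}
    (hb : KillsOne G n one b) (hb' : KillsOne G n one b') :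
    ∀ E ∈ G, 0 < E → b' E = b E := by
  intro E
  induction E using hG.wellFounded.induction with
  | h E ih =>
    intro hE hpos
    rw [killsOne_iff hG] at hb hb'
    have h := (hb' E hE).trans (hb E hE).symm
    rw [killCoeff_eq_add_killRest hG hn one b hE hpos,
      killCoeff_eq_add_killRest hG hn one b' hE hpos,
      killRest_congr hG n one fun x hx hx0 hxE => ih x ⟨hxE, hx, hE⟩ hx hx0] at h
    exact hone.1.1 (add_right_cancel h)

end Coefficients

section ModuleRelation

variable {G : Set ℝ} {C D : Type*} [AddCommGroup C] [AddCommGroup D]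

open Classical in
theorem finsum_energies_pair {M : Type*} [AddCommMonoid M] (hG : IsDiscreteSubmonoid G)
    {E e : ℝ} (he : e ≤ E) (X : ℝ → ℝ → M) :
    (∑ᶠ (μ : ℝ) (ν : ℝ), if μ ∈ G ∧ ν ∈ G ∧ μ + ν = e then X μ ν else 0) =
      ∑ μ ∈ hG.energies E, ∑ ν ∈ hG.energies E, if μ + ν = e then X μ ν else 0 := by
  have hν (μ : ℝ) : (∑ᶠ ν : ℝ, if μ ∈ G ∧ ν ∈ G ∧ μ + ν = e then X μ ν else 0) =
      ∑ ν ∈ hG.energies E, if μ ∈ G ∧ ν ∈ G ∧ μ + ν = e then X μ ν else 0 :=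
    finsum_eq_sum_of_forall_notMem _ fun ν hν => if_neg fun h =>
      hν (hG.mem_energies.2 ⟨h.2.1, by linarith [hG.nonneg _ h.1]⟩)
  simp only [hν]
  rw [finsum_eq_sum_of_forall_notMem (hG.energies E)]
  · exact Finset.sum_congr rfl fun μ hμ => Finset.sum_congr rfl fun ν hν =>
      if_congr ⟨fun h => h.2.2, fun h =>
        ⟨(hG.mem_energies.1 hμ).1, (hG.mem_energies.1 hν).1, h⟩⟩ rfl rfl
  · exact fun μ hμ => Finset.sum_eq_zero fun ν _ => if_neg fun h =>
      hμ (hG.mem_energies.2 ⟨h.1, by linarith [hG.nonneg _ h.2.1]⟩)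

theorem ops_insertAt {m : ℕ → ℝ → (ℕ → C) → C} {n : ℕ → ℝ → D → (ℕ → C) → D}
    (hm : OpsMultilinear m) (hn : ModOpsMultilinear n) (μ ν : ℝ) (y : D) (cs : List C) {i j : ℕ}
    (hij : j + i ≤ cs.length) :
    n (cs.length + 1 - i) μ y
        (insertAt (fun t => cs.getD t 0) j i (m i ν fun t => cs.getD (j + t) 0)) =
      listModOp n μ y
        (cs.take j ++ listOp m ν ((cs.drop j).take i) :: cs.drop (j + i)) := by
  have hop : m i ν (fun t => cs.getD (j + t) 0) = listOp m ν ((cs.drop j).take i) := by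
    have hlen : ((cs.drop j).take i).length = i := by simp; omega
    rw [listOp, hlen]
    refine hm.1 _ _ _ _ fun t ht => ?_
    simp [List.getD_eq_getElem?_getD, ht]
  rw [hop]
  refine listModOp_eq hn _ _ _ _ _ (by simp; omega) fun t _ => ?_
  have hj : (cs.take j).length = j := by simp; omega
  unfold insertAt
  split_ifs with h₁ h₂
  · rw [List.getD_append _ _ _ _ (by omega)]
    simp [List.getD_eq_getElem?_getD, h₁]
  · rw [List.getD_append_right _ _ _ _ (by omega)]
    simp [hj, h₂]
  · rw [List.getD_append_right _ _ _ _ (by omega), hj]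
    obtain ⟨d, rfl⟩ : ∃ d, t = j + (d + 1) := ⟨t - j - 1, by omega⟩
    simp only [Nat.add_sub_cancel_left, List.getD_cons_succ]
    simp only [List.getD_eq_getElem?_getD, List.getElem?_drop]
    congr 2
    omega

theorem module_relation [Module (ZMod 2) C] [Module (ZMod 2) D]
    (hG : IsDiscreteSubmonoid G) {m : ℕ → ℝ → (ℕ → C) → C}
    {n : ℕ → ℝ → D → (ℕ → C) → D} (hm : OpsMultilinear m) (hn : IsGappedAInfModule G m n)
    (b : ℝ → C) (y : D) {E e : ℝ} (he : e ∈ hG.energies E) {l : List ℝ} (hl : l ∈ hG.words E) :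
    (∑ q ∈ hG.energies E ×ˢ hG.energies E ×ˢ hG.words E ×ˢ hG.words E,
      if (q.1 + q.2.1, q.2.2.1 ++ q.2.2.2) = (e, l) then
        listModOp n q.1 (listModOp n q.2.1 y (q.2.2.1.map b)) (q.2.2.2.map b) else 0) +
    (∑ q ∈ hG.energies E ×ˢ hG.energies E ×ˢ hG.words E ×ˢ hG.words E ×ˢ hG.words E,
      if (q.1 + q.2.1, q.2.2.1 ++ (q.2.2.2.1 ++ q.2.2.2.2)) = (e, l) then
        listModOp n q.1 y
          (q.2.2.1.map b ++ listOp m q.2.1 (q.2.2.2.1.map b) :: q.2.2.2.2.map b)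
      else 0) = 0 := by
  classical
  obtain ⟨heG, heE⟩ := hG.mem_energies.1 he
  have h := hn.2 e heG l.length y fun t => (l.map b).getD t 0
  have h₁ (μ ν : ℝ) :
      (∑ᶠ (i : ℕ) (_ : μ ∈ G ∧ ν ∈ G ∧ μ + ν = e ∧ i ≤ l.length),
        n (l.length - i) μ (n i ν y fun t => (l.map b).getD t 0)
          fun t => (l.map b).getD (i + t) 0) =
      if μ ∈ G ∧ ν ∈ G ∧ μ + ν = e then
        ∑ l₁ ∈ hG.words E, ∑ l₂ ∈ hG.words E, if l₁ ++ l₂ = l then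
          listModOp n μ (listModOp n ν y (l₁.map b)) (l₂.map b) else 0
      else 0 := by
    split_ifs with hc
    · rw [sum_words_append hG hl fun l₁ l₂ =>
        listModOp n μ (listModOp n ν y (l₁.map b)) (l₂.map b)]
      rw [finsum_eq_sum_of_forall_notMem (Finset.range (l.length + 1))]
      · refine Finset.sum_congr rfl fun i hi => ?_
        have hi' : i ≤ l.length := Nat.lt_succ_iff.1 (Finset.mem_range.1 hi)
        rw [finsum_eq_if, if_pos ⟨hc.1, hc.2.1, hc.2.2, hi'⟩,
          listModOp_eq hn.1 ν y ((l.take i).map b) i, listModOp_eq hn.1 μ _ ((l.drop i).map b)]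
        · simp
        · intro t _
          simp [List.getD_eq_getElem?_getD]
        · simpa using hi'
        · intro t ht
          simp [List.getD_eq_getElem?_getD, ht]
      · intro i hi
        rw [finsum_eq_if, if_neg]
        exact fun hc => hi (Finset.mem_range.2 (Nat.lt_succ_iff.2 hc.2.2.2))
    · exact finsum_eq_zero_of_forall_eq_zero fun i => by
        rw [finsum_eq_if, if_neg fun h => hc ⟨h.1, h.2.1, h.2.2.1⟩]
  have h₂ (μ ν : ℝ) :
      (∑ᶠ (i : ℕ) (j : ℕ) (_ : μ ∈ G ∧ ν ∈ G ∧ μ + ν = e ∧ j + i ≤ l.length),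
        n (l.length + 1 - i) μ y (insertAt (fun t => (l.map b).getD t 0) j i
          (m i ν fun t => (l.map b).getD (j + t) 0))) =
      if μ ∈ G ∧ ν ∈ G ∧ μ + ν = e then
        ∑ l₁ ∈ hG.words E, ∑ l₂ ∈ hG.words E, ∑ l₃ ∈ hG.words E, if l₁ ++ (l₂ ++ l₃) = l then
          listModOp n μ y (l₁.map b ++ listOp m ν (l₂.map b) :: l₃.map b) else 0
      else 0 := by
    split_ifs with hc
    · rw [sum_words_append_append hG hl fun l₁ l₂ l₃ =>
        listModOp n μ y (l₁.map b ++ listOp m ν (l₂.map b) :: l₃.map b)]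
      simp only [finsum_eq_if, hc, true_and]
      rw [finsum_eq_sum_of_forall_notMem (Finset.range (l.length + 1))]
      · refine Finset.sum_congr rfl fun i _ => ?_
        rw [finsum_eq_sum_of_forall_notMem (Finset.range (l.length + 1))]
        · refine Finset.sum_congr rfl fun j _ => if_ctx_congr Iff.rfl (fun hij => ?_) fun _ => rfl
          have := ops_insertAt hm hn.1 μ ν y (l.map b) (i := i) (j := j) (by simpa using hij)
          simpa only [List.length_map, List.map_take, List.map_drop] using this
        · exact fun j hj => if_neg fun h => hj (Finset.mem_range.2 (by omega))
      · refine fun i hi => finsum_eq_zero_of_forall_eq_zero fun j => if_neg fun h =>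
          hi (Finset.mem_range.2 (by omega))
    · exact finsum_eq_zero_of_forall_eq_zero fun i => finsum_eq_zero_of_forall_eq_zero fun j => by
        rw [finsum_eq_if, if_neg fun h => hc ⟨h.1, h.2.1, h.2.2.1⟩]
  simp only [h₁, h₂] at h
  rw [finsum_energies_pair hG heE, finsum_energies_pair hG heE] at h
  simpa only [Finset.sum_product, Prod.mk.injEq, ite_and, Finset.sum_ite_irrel,
    Finset.sum_const_zero] using h

theorem sum_outer_compositions (hG : IsDiscreteSubmonoid G) {n : ℕ → ℝ → D → (ℕ → C) → D}
    (hn : ModOpsMultilinear n) {one : ℝ → D} {b : ℝ → C} (hb : KillsOne G n one b) (E : ℝ) :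
    (∑ κ ∈ hG.energies E, ∑ a ∈ hG.energies E ×ˢ hG.words E, if a.1 + κ + a.2.sum = E then
      ∑ q ∈ hG.energies E ×ˢ hG.energies E ×ˢ hG.words E ×ˢ hG.words E,
        if (q.1 + q.2.1, q.2.2.1 ++ q.2.2.2) = a then
          listModOp n q.1 (listModOp n q.2.1 (one κ) (q.2.2.1.map b)) (q.2.2.2.map b) else 0
      else 0) = 0 := by
  calc
    _ = ∑ κ ∈ hG.energies E,
          ∑ q ∈ hG.energies E ×ˢ hG.energies E ×ˢ hG.words E ×ˢ hG.words E,
            if q.1 + q.2.1 + κ + (q.2.2.1 ++ q.2.2.2).sum = E then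
              listModOp n q.1 (listModOp n q.2.1 (one κ) (q.2.2.1.map b)) (q.2.2.2.map b)
            else 0 := by
      refine Finset.sum_congr rfl fun κ hκ => ?_
      refine Finset.sum_ite_sum_fiber _ _ (fun q : ℝ × ℝ × List ℝ × List ℝ =>
        (q.1 + q.2.1, q.2.2.1 ++ q.2.2.2)) _
        (fun a : ℝ × List ℝ => a.1 + κ + a.2.sum = E) ?_
      rintro ⟨μ, ν, l₁, l₂⟩ hq hE
      simp only [Finset.mem_product] at hq
      obtain ⟨hμ, hν, h₁, h₂⟩ := hq
      have s₁ := hG.sum_nonneg_of_mem_words h₁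
      have s₂ := hG.sum_nonneg_of_mem_words h₂
      rw [hG.mem_energies] at hκ hμ hν
      have := hG.nonneg _ hκ.1
      have := hG.nonneg _ hμ.1
      have := hG.nonneg _ hν.1
      simp only [List.sum_append] at hE
      simp only [Finset.mem_product, hG.append_mem_words, hG.mem_energies]
      exact ⟨⟨hG.add_mem _ hμ.1 _ hν.1, by linarith⟩, h₁, h₂, by linarith⟩
    _ = ∑ p ∈ hG.energies E ×ˢ hG.words E,
          ∑ r ∈ hG.words E ×ˢ hG.energies E ×ˢ hG.energies E,
            if p.1 + (r.2.1 + r.2.2 + r.1.sum) + p.2.sum = E then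
              listModOpLeft hn p.1 (p.2.map b) (listModOp n r.2.1 (one r.2.2) (r.1.map b))
            else 0 := by
      rw [← Finset.sum_product', ← Finset.sum_product']
      refine Finset.sum_nbij' (fun x => ((x.2.1, x.2.2.2.2), (x.2.2.2.1, x.2.2.1, x.1)))
        (fun x => (x.2.2.2, x.1.1, x.2.2.1, x.2.1, x.1.2)) ?_ ?_ ?_ ?_ ?_
      · simp only [Finset.mem_product]
        tauto
      · simp only [Finset.mem_product]
        tauto
      · exact fun _ _ => rfl
      · exact fun _ _ => rfl
      · rintro ⟨κ, μ, ν, l₁, l₂⟩ _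
        refine if_congr ?_ rfl rfl
        simp only [List.sum_append]
        constructor <;> intro h <;> linarith
    _ = ∑ p ∈ hG.energies E ×ˢ hG.words E, ∑ e ∈ hG.energies E, if p.1 + e + p.2.sum = E then
          listModOpLeft hn p.1 (p.2.map b) (killCoeff hG n one b E e) else 0 := by
      refine Finset.sum_congr rfl fun p hp => ?_
      simp only [killCoeff, map_sum, apply_ite (listModOpLeft hn p.1 (p.2.map b)), map_zero]
      symm
      refine Finset.sum_ite_sum_fiber _ _ (fun r : List ℝ × ℝ × ℝ => r.2.1 + r.2.2 + r.1.sum) _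
        (fun e => p.1 + e + p.2.sum = E) ?_
      rintro ⟨l, μ, ν⟩ hr hE
      simp only [Finset.mem_product] at hr hp
      obtain ⟨hl, hμ, hν⟩ := hr
      have := hG.sum_nonneg_of_mem_words hp.2
      have hp1 := hG.nonneg _ (hG.mem_energies.1 hp.1).1
      exact hG.mem_energies.2 ⟨hG.add_mem _ (hG.add_mem _ (hG.mem_energies.1 hμ).1 _
        (hG.mem_energies.1 hν).1) _ (hG.sum_mem_of_mem_words hl), by linarith⟩
    _ = 0 := by
      refine Finset.sum_eq_zero fun p _ => Finset.sum_eq_zero fun e he => ?_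
      obtain ⟨heG, heE⟩ := hG.mem_energies.1 he
      rw [killCoeff_eq hG n one b heE, (killsOne_iff hG n one b).1 hb e heG, map_zero, ite_self]

theorem sum_inner_compositions (hG : IsDiscreteSubmonoid G) {m : ℕ → ℝ → (ℕ → C) → C}
    {n : ℕ → ℝ → D → (ℕ → C) → D} (hn : ModOpsMultilinear n) (one : ℝ → D) (b : ℝ → C) {E : ℝ}
    (hE : E ∈ G) (hb : ∀ e ∈ G, e < E → mcCoeff hG m b E e = 0) :
    (∑ κ ∈ hG.energies E, ∑ a ∈ hG.energies E ×ˢ hG.words E, if a.1 + κ + a.2.sum = E then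
      ∑ q ∈ hG.energies E ×ˢ hG.energies E ×ˢ hG.words E ×ˢ hG.words E ×ˢ hG.words E,
        if (q.1 + q.2.1, q.2.2.1 ++ (q.2.2.2.1 ++ q.2.2.2.2)) = a then
          listModOp n q.1 (one κ)
            (q.2.2.1.map b ++ listOp m q.2.1 (q.2.2.2.1.map b) :: q.2.2.2.2.map b)
        else 0
      else 0) = listModOp n 0 (one 0) [mcCoeff hG m b E E] := by
  calc
    _ = ∑ κ ∈ hG.energies E,
          ∑ q ∈ hG.energies E ×ˢ hG.energies E ×ˢ hG.words E ×ˢ hG.words E ×ˢ hG.words E,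
            if q.1 + q.2.1 + κ + (q.2.2.1 ++ (q.2.2.2.1 ++ q.2.2.2.2)).sum = E then
              listModOp n q.1 (one κ)
                (q.2.2.1.map b ++ listOp m q.2.1 (q.2.2.2.1.map b) :: q.2.2.2.2.map b)
            else 0 := by
      refine Finset.sum_congr rfl fun κ hκ => ?_
      refine Finset.sum_ite_sum_fiber _ _
        (fun q : ℝ × ℝ × List ℝ × List ℝ × List ℝ =>
          (q.1 + q.2.1, q.2.2.1 ++ (q.2.2.2.1 ++ q.2.2.2.2))) _
        (fun a : ℝ × List ℝ => a.1 + κ + a.2.sum = E) ?_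
      rintro ⟨μ, ν, l₁, l₂, l₃⟩ hq hE
      simp only [Finset.mem_product] at hq
      obtain ⟨hμ, hν, h₁, h₂, h₃⟩ := hq
      have s₁ := hG.sum_nonneg_of_mem_words h₁
      have s₂ := hG.sum_nonneg_of_mem_words h₂
      have s₃ := hG.sum_nonneg_of_mem_words h₃
      rw [hG.mem_energies] at hκ hμ hν
      have := hG.nonneg _ hκ.1
      have := hG.nonneg _ hμ.1
      have := hG.nonneg _ hν.1
      simp only [List.sum_append] at hE
      simp only [Finset.mem_product, hG.append_mem_words, hG.mem_energies, List.sum_append]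
      exact ⟨⟨hG.add_mem _ hμ.1 _ hν.1, by linarith⟩, h₁, ⟨h₂, h₃, by linarith⟩, by linarith⟩
    _ = ∑ p ∈ (hG.energies E ×ˢ hG.energies E) ×ˢ hG.words E ×ˢ hG.words E,
          ∑ r ∈ hG.words E ×ˢ hG.energies E,
            if p.1.1 + p.1.2 + p.2.1.sum + p.2.2.sum + (r.2 + r.1.sum) = E then
              listModOpMid hn p.1.1 (one p.1.2) (p.2.1.map b) (p.2.2.map b)
                (listOp m r.2 (r.1.map b))
            else 0 := by
      rw [← Finset.sum_product', ← Finset.sum_product']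
      refine Finset.sum_nbij'
        (fun x => (((x.2.1, x.1), (x.2.2.2.1, x.2.2.2.2.2)), (x.2.2.2.2.1, x.2.2.1)))
        (fun x => (x.1.1.2, x.1.1.1, x.2.2, x.1.2.1, x.2.1, x.1.2.2)) ?_ ?_ ?_ ?_ ?_
      · simp only [Finset.mem_product]
        tauto
      · simp only [Finset.mem_product]
        tauto
      · exact fun _ _ => rfl
      · exact fun _ _ => rfl
      · rintro ⟨κ, μ, ν, l₁, l₂, l₃⟩ _
        refine if_congr ?_ rfl rfl
        simp only [List.sum_append]
        constructor <;> intro h <;> linarith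
    _ = ∑ p ∈ (hG.energies E ×ˢ hG.energies E) ×ˢ hG.words E ×ˢ hG.words E,
          ∑ e ∈ hG.energies E,
            if p.1.1 + p.1.2 + p.2.1.sum + p.2.2.sum + e = E then
              listModOpMid hn p.1.1 (one p.1.2) (p.2.1.map b) (p.2.2.map b)
                (mcCoeff hG m b E e)
            else 0 := by
      refine Finset.sum_congr rfl fun p hp => ?_
      simp only [mcCoeff, map_sum,
        apply_ite (listModOpMid hn p.1.1 (one p.1.2) (p.2.1.map b) (p.2.2.map b)), map_zero]
      symm
      refine Finset.sum_ite_sum_fiber _ _ (fun r : List ℝ × ℝ => r.2 + r.1.sum) _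
        (fun e => p.1.1 + p.1.2 + p.2.1.sum + p.2.2.sum + e = E) ?_
      rintro ⟨l, μ⟩ hr hE
      simp only [Finset.mem_product] at hr hp
      have := hG.sum_nonneg_of_mem_words hp.2.1
      have := hG.sum_nonneg_of_mem_words hp.2.2
      have := hG.nonneg _ (hG.mem_energies.1 hp.1.1).1
      have := hG.nonneg _ (hG.mem_energies.1 hp.1.2).1
      exact hG.mem_energies.2 ⟨hG.add_mem _ (hG.mem_energies.1 hr.2).1 _
        (hG.sum_mem_of_mem_words hr.1), by linarith⟩
    _ = ∑ p ∈ (hG.energies E ×ˢ hG.energies E) ×ˢ hG.words E ×ˢ hG.words E,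
          if p = ((0, 0), [], []) then listModOp n 0 (one 0) [mcCoeff hG m b E E] else 0 := by
      refine Finset.sum_congr rfl fun p hp => ?_
      have hEmem : E ∈ hG.energies E := hG.mem_energies.2 ⟨hE, le_rfl⟩
      rw [Finset.sum_eq_single_of_mem E hEmem]
      · obtain ⟨⟨μ, κ⟩, l₁, l₃⟩ := p
        simp only [Finset.mem_product] at hp
        obtain ⟨⟨hμ, hκ⟩, h₁, h₃⟩ := hp
        have s₁ := hG.sum_nonneg_of_mem_words h₁
        have s₃ := hG.sum_nonneg_of_mem_words h₃
        have e₁ := hG.nonneg _ (hG.mem_energies.1 hμ).1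
        have e₃ := hG.nonneg _ (hG.mem_energies.1 hκ).1
        by_cases hsum : μ + κ + l₁.sum + l₃.sum + E = E
        · obtain rfl : μ = 0 := by linarith
          obtain rfl : κ = 0 := by linarith
          obtain rfl := hG.eq_nil_of_sum_le_zero h₁ (by linarith)
          obtain rfl := hG.eq_nil_of_sum_le_zero h₃ (by linarith)
          rw [if_pos hsum, if_pos rfl]
          rfl
        · rw [if_neg hsum, if_neg]
          rintro h
          simp only [Prod.mk.injEq] at h
          obtain ⟨⟨rfl, rfl⟩, rfl, rfl⟩ := h
          simp at hsum
      · intro e he hne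
        obtain ⟨heG, heE⟩ := hG.mem_energies.1 he
        rw [hb e heG (lt_of_le_of_ne heE hne), map_zero, ite_self]
    _ = _ := by
      rw [Finset.sum_ite_eq', if_pos]
      simp [hG.mem_energies, hG.mem_words, hG.zero_mem, hG.nonneg E hE]

theorem KillsOne.isBoundingCochain [Module (ZMod 2) C] [Module (ZMod 2) D]
    (hG : IsDiscreteSubmonoid G) {m : ℕ → ℝ → (ℕ → C) → C}
    {n : ℕ → ℝ → D → (ℕ → C) → D} {one : ℝ → D} (hm : OpsMultilinear m)
    (hm₀ : ∀ x : ℕ → C, m 0 0 x = 0) (hn : IsGappedAInfModule G m n)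
    (hone : IsCyclicElement n one) {b : ℝ → C} (hb : KillsOne G n one b) :
    IsBoundingCochain G m b := by
  rw [isBoundingCochain_iff hG]
  intro E
  induction E using hG.wellFounded.induction with
  | h E ih =>
    intro hE _
    have hlower : ∀ e ∈ G, e < E → mcCoeff hG m b E e = 0 := fun e he heE => by
      rw [mcCoeff_eq hG m b heE.le]
      rcases (hG.nonneg e he).eq_or_lt with rfl | hpos
      · exact mcCoeff_zero hG b hm₀
      · exact ih e ⟨heE, he, hE⟩ he hpos
    have h := congrArg₂ (· + ·) (sum_outer_compositions hG hn.1 hb E)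
      (sum_inner_compositions (m := m) hG hn.1 one b hE hlower)
    simp only [← Finset.sum_add_distrib, zero_add] at h
    rw [Finset.sum_eq_zero] at h
    · apply hone.1.1
      have hzero : listModOp n 0 (one 0) [(0 : C)] = 0 :=
        (listModOpMid hn.1 0 (one 0) [] []).map_zero
      have hop (c : C) : (n 1 0 (one 0) fun _ => c) = listModOp n 0 (one 0) [c] :=
        listModOp_eq hn.1 0 (one 0) [c] 1 _ rfl (by simp)
      simp only [hop, hzero, ← h]
    · refine fun κ _ => Finset.sum_eq_zero fun a ha => ?_
      obtain ⟨ha₁, ha₂⟩ := Finset.mem_product.1 ha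
      split_ifs
      · exact module_relation hG hm hn b (one κ) ha₁ ha₂
      · exact add_zero 0

end ModuleRelation

/-- **Proposition 3.5.** Given a discrete submonoid `G` of `ℝ≥0`, a `G`-gapped filtered
`A∞`-algebra `(C̄, m)` over `ℤ/2`, a `G`-gapped right filtered `A∞`-module `(D̄, n)` over it,
and a `G`-gapped cyclic element `𝟏` of `D`, there is a unique `G`-gapped element `b` of
`C ⊗ Λ₊` with `d^b(𝟏) = 0`, and this unique `b` is a bounding cochain (it satisfies the
Maurer–Cartan equation). -/
theorem fukaya_prop_3_5 (G : Set ℝ) (hG : IsDiscreteSubmonoid G)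
    {C D : Type*} [AddCommGroup C] [Module (ZMod 2) C] [AddCommGroup D] [Module (ZMod 2) D]
    (m : ℕ → ℝ → (ℕ → C) → C) (n : ℕ → ℝ → D → (ℕ → C) → D) (one : ℝ → D)
    (hm : IsGappedAInfAlgebra G m) (hn : IsGappedAInfModule G m n)
    (hone : IsCyclicElement n one) :
    ∃ b : ℝ → C,
      KillsOne G n one b ∧
      IsBoundingCochain G m b ∧
      ∀ b' : ℝ → C, KillsOne G n one b' → ∀ lam ∈ G, 0 < lam → b' lam = b lam := by
  obtain ⟨b, hb⟩ := exists_killsOne hG hn.1 hone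
  exact ⟨b, hb, hb.isBoundingCochain hG hm.1 hm.2.1 hn hone,
    fun _ hb' => killsOne_unique hG hn.1 hone hb hb'⟩
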